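/- (Main Adams trace theorem, p ≤ 1 case) Let μ be a nonnegative Radon measure on ℝⁿ, p₁,…,p_m ∈ (1,∞), 1/p = ∑ 1/p_j. Suppose 0 < p ≤ p₀ < n/α, 0 < p ≤ 1, and 0 < β ≤ α < mn. Set θ = (n−βp₀)/(n−αp₀), q = θp, q₀ = θp₀. Then ‖I_α(f⃗)‖_{M_μ^{q,q₀}} ≲ ‖μ‖_{n−βp}^{1/q} ‖f⃗‖_{M^{P⃗,p₀}}. -/

import Mathlib

open MeasureTheory ENNReal

noncomputable section

variable {n : ℕ}

/-- Axis-parallel cube with lower corner `a` and side length `r` (half-open). -/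
def cube (a : Fin n → ℝ) (r : ℝ) : Set (Fin n → ℝ) :=
  {y | ∀ i, a i ≤ y i ∧ y i < a i + r}

/-- The dyadic cube `2^{-k}(m + [0,1)^n)`. -/
def dyadicCube (k : ℤ) (mv : Fin n → ℤ) : Set (Fin n → ℝ) :=
  cube (fun i => (mv i : ℝ) * (2 : ℝ) ^ (-k)) ((2 : ℝ) ^ (-k))

/-- The concentric triple `3Q` of the cube with corner `a` and side `r`. -/
def tripleCube (a : Fin n → ℝ) (r : ℝ) : Set (Fin n → ℝ) :=
  cube (fun i => a i - r) (3 * r)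

/-- The Morrey norm `‖f‖_{M^{p,p₀}}`. -/
def morreyNorm (p p0 : ℝ) (f : (Fin n → ℝ) → ℝ) : ℝ≥0∞ :=
  ⨆ (a : Fin n → ℝ) (r : ℝ) (_ : 0 < r),
    volume (cube a r) ^ (1 / p0 - 1 / p) *
      (∫⁻ x in cube a r, ENNReal.ofReal |f x| ^ p) ^ (1 / p)

/-- The product Morrey norm `‖f⃗‖_{M^{P⃗,p₀}}`. -/
def prodMorreyNorm {m : ℕ} (P : Fin m → ℝ) (p p0 : ℝ)
    (f : Fin m → (Fin n → ℝ) → ℝ) : ℝ≥0∞ :=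
  ⨆ (a : Fin n → ℝ) (r : ℝ) (_ : 0 < r),
    volume (cube a r) ^ (1 / p0 - 1 / p) *
      ∏ j, (∫⁻ x in cube a r, ENNReal.ofReal |f j x| ^ P j) ^ (1 / P j)

/-- The Radon–Morrey norm `‖g‖_{M_μ^{q,q₀}}`. -/
def radonMorreyNorm (μ : Measure (Fin n → ℝ)) (q q0 : ℝ)
    (g : (Fin n → ℝ) → ℝ≥0∞) : ℝ≥0∞ :=
  ⨆ (a : Fin n → ℝ) (r : ℝ) (_ : 0 < r),
    volume (cube a r) ^ (1 / q0 - 1 / q) * (∫⁻ x in cube a r, g x ^ q ∂μ) ^ (1 / q)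

/-- The growth norm `‖μ‖_β := sup_Q μ(Q)/ℓ_Q^β`. -/
def measureGrowthNorm (μ : Measure (Fin n → ℝ)) (β : ℝ) : ℝ≥0∞ :=
  ⨆ (a : Fin n → ℝ) (r : ℝ) (_ : 0 < r), μ (cube a r) / ENNReal.ofReal r ^ β

/-- The `m`-sublinear fractional maximal operator `𝔐_α`. -/
def fracMaximal {m : ℕ} (α : ℝ) (f : Fin m → (Fin n → ℝ) → ℝ)
    (x : Fin n → ℝ) : ℝ≥0∞ :=
  ⨆ (a : Fin n → ℝ) (r : ℝ) (_ : 0 < r) (_ : x ∈ cube a r),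
    ENNReal.ofReal r ^ (α - (m : ℝ) * n) *
      ∏ j, ∫⁻ y in cube a r, ENNReal.ofReal |f j y|

/-- The dyadic `m`-sublinear fractional maximal operator `𝔐_α^𝒟`. -/
def dyadicFracMaximal {m : ℕ} (α : ℝ) (f : Fin m → (Fin n → ℝ) → ℝ)
    (x : Fin n → ℝ) : ℝ≥0∞ :=
  ⨆ (k : ℤ) (mv : Fin n → ℤ) (_ : x ∈ dyadicCube k mv),
    ENNReal.ofReal ((2 : ℝ) ^ (-k)) ^ (α - (m : ℝ) * n) *
      ∏ j, ∫⁻ y in dyadicCube k mv, ENNReal.ofReal |f j y|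

/-- The dyadic `m`-linear fractional integral operator `ℑ_α^𝒟`. -/
def dyadicFracIntegral {m : ℕ} (α : ℝ) (f : Fin m → (Fin n → ℝ) → ℝ)
    (x : Fin n → ℝ) : ℝ≥0∞ :=
  ∑' qk : ℤ × (Fin n → ℤ),
    (dyadicCube qk.1 qk.2).indicator
      (fun _ => ENNReal.ofReal ((2 : ℝ) ^ (-qk.1)) ^ (α - (m : ℝ) * n) *
        ∏ j, ∫⁻ y in dyadicCube qk.1 qk.2, ENNReal.ofReal |f j y|) x

/-- The `m`-linear fractional integral operator `ℑ_α` (with Euclidean distances). -/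
def fracIntegral {m : ℕ} (α : ℝ) (f : Fin m → (Fin n → ℝ) → ℝ)
    (x : Fin n → ℝ) : ℝ≥0∞ :=
  ∫⁻ y : Fin m → Fin n → ℝ,
    (∏ j, ENNReal.ofReal |f j (y j)|) /
      ENNReal.ofReal ((∑ j, Real.sqrt (∑ i, (x i - y j i) ^ 2)) ^ ((m : ℝ) * n - α))


/-- `2^{kδ}` as an extended nonnegative real. -/
def pw (k : ℤ) (δ : ℝ) : ℝ≥0∞ := (2 : ℝ≥0∞) ^ ((k : ℝ) * δ)

lemma pw_ne_zero (k : ℤ) (δ : ℝ) : pw k δ ≠ 0 := by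
  unfold pw
  have := ENNReal.rpow_pos (p := (k : ℝ) * δ) (by norm_num : (0 : ℝ≥0∞) < 2) (by norm_num)
  exact this.ne'

lemma pw_ne_top (k : ℤ) (δ : ℝ) : pw k δ ≠ ∞ := by
  unfold pw
  exact ENNReal.rpow_ne_top_of_ne_zero (by norm_num) (by norm_num)

lemma pw_add (k : ℤ) (a b : ℝ) : pw k (a + b) = pw k a * pw k b := by
  unfold pw
  rw [mul_add, ENNReal.rpow_add _ _ (by norm_num) (by norm_num)]

lemma pw_rpow (k : ℤ) (a b : ℝ) : pw k a ^ b = pw k (a * b) := by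
  unfold pw
  rw [← ENNReal.rpow_mul, mul_assoc]

lemma pw_zero (k : ℤ) : pw k 0 = 1 := by simp [pw]

lemma pw_one_eq_zpow (k : ℤ) : pw k 1 = (2 : ℝ≥0∞) ^ k := by
  unfold pw
  rw [mul_one, ENNReal.rpow_intCast]

lemma pw_eq_one_rpow (k : ℤ) (a : ℝ) : pw k a = pw k 1 ^ a := by
  rw [pw_rpow, one_mul]

lemma pw_one_eq_ofReal (k : ℤ) : pw k 1 = ENNReal.ofReal ((2 : ℝ) ^ k) := by
  unfold pw
  rw [mul_one, ← Real.rpow_intCast, ← ENNReal.ofReal_rpow_of_pos (by norm_num)]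
  simp

lemma pw_neg (k : ℤ) (a : ℝ) : pw (-k) a = pw k (-a) := by
  unfold pw; push_cast; congr 1; ring

lemma pw_succ (k : ℤ) (a : ℝ) : pw (k + 1) a = (2 : ℝ≥0∞) ^ a * pw k a := by
  unfold pw; push_cast
  rw [← ENNReal.rpow_add _ _ (by norm_num) (by norm_num)]; congr 1; ring

lemma pw_one_mono {k l : ℤ} (h : k ≤ l) : pw k 1 ≤ pw l 1 := by
  unfold pw
  apply ENNReal.rpow_le_rpow_of_exponent_le (by norm_num)
  simpa using h

lemma le_of_pw_one_le {k l : ℤ} (h : pw k 1 ≤ pw l 1) : k ≤ l := by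
  by_contra! hh
  have : pw (l+1) 1 ≤ pw l 1 := (pw_one_mono (by omega)).trans h
  rw [pw_succ] at this
  have h2 : pw l 1 < 2 ^ (1:ℝ) * pw l 1 := by
    rw [ENNReal.rpow_one, two_mul]
    exact ENNReal.lt_add_right (pw_ne_top _ _) (pw_ne_zero _ _)
  exact absurd this (not_le.2 h2)

/-- The geometric constant. -/
def geoC (δ : ℝ) : ℝ≥0∞ := (1 - (2 : ℝ≥0∞) ^ (-δ))⁻¹

lemma geoC_ne_top {δ : ℝ} (hδ : 0 < δ) : geoC δ ≠ ∞ := by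
  unfold geoC
  rw [ENNReal.inv_ne_top, Ne, tsub_eq_zero_iff_le, not_le]
  exact ENNReal.rpow_lt_one_of_one_lt_of_neg (by norm_num) (by linarith)

lemma geoC_ne_zero (δ : ℝ) : geoC δ ≠ 0 := by
  unfold geoC
  rw [ENNReal.inv_ne_zero]
  exact (lt_of_le_of_lt tsub_le_self ENNReal.one_lt_top).ne

open Classical in
lemma geo_le_int {δ : ℝ} (K : ℤ) :
    ∑' k : ℤ, (if k ≤ K then pw k δ else 0) ≤ geoC δ * pw K δ := by
  have hsupp : Function.support (fun k : ℤ => if k ≤ K then pw k δ else 0) ⊆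
      Set.range (fun i : ℕ => K - (i : ℤ)) := by
    intro k hk
    have : k ≤ K := by
      by_contra h
      simp [h] at hk
    exact ⟨(K - k).toNat, by simp; omega⟩
  have hinj : Function.Injective (fun i : ℕ => K - (i : ℤ)) := by
    intro a b h; simp at h; exact h
  rw [← hinj.tsum_eq hsupp]
  have : ∀ i : ℕ, (if K - (i:ℤ) ≤ K then pw (K - (i:ℤ)) δ else 0) =
      ((2 : ℝ≥0∞) ^ (-δ)) ^ i * pw K δ := by
    intro i
    rw [if_pos (by omega)]
    unfold pw
    rw [← ENNReal.rpow_natCast, ← ENNReal.rpow_mul,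
      ← ENNReal.rpow_add _ _ (by norm_num) (by norm_num)]
    congr 1; push_cast; ring
  simp_rw [this]
  rw [ENNReal.tsum_mul_right, ENNReal.tsum_geometric]
  rfl

open Classical in
lemma geo_le {δ : ℝ} (hδ : 0 < δ) (X : ℝ≥0∞) :
    ∑' k : ℤ, (if pw k 1 ≤ X then pw k δ else 0) ≤ geoC δ * X ^ δ := by
  by_cases hX0 : X = 0
  · subst hX0
    simp [pw_ne_zero]
  by_cases hXt : X = ∞
  · subst hXt
    rw [ENNReal.top_rpow_of_pos hδ, ENNReal.mul_top (geoC_ne_zero _)]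
    exact le_top
  obtain ⟨K, hK1, hK2⟩ := ENNReal.exists_mem_Ico_zpow hX0 hXt (y := 2) (by norm_num) (by norm_num)
  rw [← pw_one_eq_zpow] at hK1 hK2
  calc _ ≤ ∑' k : ℤ, (if k ≤ K then pw k δ else 0) := by
        refine ENNReal.tsum_le_tsum fun k => ?_
        by_cases hk : pw k 1 ≤ X
        · rw [if_pos hk, if_pos]
          by_contra! hh
          exact absurd ((pw_one_mono (show K + 1 ≤ k by omega)).trans hk) (not_le.2 hK2)
        · rw [if_neg hk]; exact zero_le
    _ ≤ geoC δ * pw K δ := geo_le_int K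
    _ ≤ _ := by
      gcongr
      rw [pw_eq_one_rpow]
      gcongr

open Classical in
lemma geo_ge {δ : ℝ} (hδ : 0 < δ) (X : ℝ≥0∞) :
    ∑' k : ℤ, (if X ≤ pw k 1 then pw k (-δ) else 0) ≤ geoC δ * X ^ (-δ) := by
  have h := geo_le hδ X⁻¹
  rw [ENNReal.rpow_neg, ← ENNReal.inv_rpow]
  refine le_trans (le_of_eq ?_) h
  rw [← (Equiv.neg ℤ).tsum_eq]
  refine tsum_congr fun k => ?_
  simp only [Equiv.neg_apply, pw_neg, neg_neg]
  have : pw k (-1) = (pw k 1)⁻¹ := by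
    rw [pw_eq_one_rpow k (-1), ENNReal.rpow_neg_one]
  rw [this]
  congr 1
  simp only [eq_iff_iff]
  exact ENNReal.le_inv_iff_le_inv

lemma rpow_tsum_le' {ι : Type*} (a : ι → ℝ≥0∞) {p : ℝ} (hp : 0 < p) (hp1 : p ≤ 1) :
    (∑' i, a i) ^ p ≤ ∑' i, a i ^ p := by
  have hfin : ∀ s : Finset ι, (∑ i ∈ s, a i) ^ p ≤ ∑ i ∈ s, a i ^ p := by
    intro s
    classical
    induction s using Finset.induction with
    | empty => simp [hp]
    | insert i s hi ih =>
      rw [Finset.sum_insert hi, Finset.sum_insert hi]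
      exact (ENNReal.rpow_add_le_add_rpow _ _ hp.le hp1).trans (by gcongr)
  rw [ENNReal.tsum_eq_iSup_sum, ← ENNReal.orderIsoRpow_apply p hp, OrderIso.map_iSup]
  refine iSup_le fun s => ?_
  rw [ENNReal.orderIsoRpow_apply]
  exact (hfin s).trans (ENNReal.sum_le_tsum s)

open Classical in
/-- dyadic layer-cake bound -/
lemma rpow_le_tsum (A : ℝ≥0∞) {s : ℝ} (hs : 0 < s) :
    A ^ s ≤ (2 : ℝ≥0∞) ^ s * ∑' i : ℤ, (if pw i 1 ≤ A then pw i s else 0) := by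
  by_cases hX0 : A = 0
  · subst hX0; simp [hs]
  by_cases hXt : A = ∞
  · subst hXt
    have : ∑' i : ℤ, (if pw i 1 ≤ ∞ then pw i s else 0) = ∞ := by
      rw [eq_top_iff]
      calc (∞:ℝ≥0∞) = ∑' i : ℕ, (1:ℝ≥0∞) := by simp
        _ ≤ ∑' i : ℕ, pw (i:ℤ) s := by
          refine ENNReal.tsum_le_tsum fun i => ?_
          unfold pw
          rw [← ENNReal.rpow_zero (x := 2)]
          apply ENNReal.rpow_le_rpow_of_exponent_le (by norm_num)
          push_cast; positivity
        _ ≤ ∑' i : ℤ, pw i s := ENNReal.tsum_comp_le_tsum_of_injective Nat.cast_injective _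
        _ ≤ _ := by simp
    rw [this, ENNReal.mul_top]
    · exact le_top
    · exact (ENNReal.rpow_pos (by norm_num) (by norm_num)).ne'
  obtain ⟨K, hK1, hK2⟩ := ENNReal.exists_mem_Ico_zpow hX0 hXt (y := 2) (by norm_num) (by norm_num)
  rw [← pw_one_eq_zpow] at hK1 hK2
  calc A ^ s ≤ pw (K+1) s := by rw [pw_eq_one_rpow]; gcongr
    _ = 2 ^ s * pw K s := pw_succ _ _
    _ ≤ _ := by
      gcongr
      refine le_trans ?_ (ENNReal.le_tsum K)
      rw [if_pos hK1]
lemma lower_pi_step {E : Type*} [MeasurableSpace E] (ν : Measure E) [SigmaFinite ν] {m : ℕ}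
    (F : Fin (m + 1) → E → ℝ≥0∞) (i : Fin (m + 1)) (hF : ∀ j x, F j x ≠ ∞) :
    ∫⁻ y, ∏ j, F j (y j) ∂(Measure.pi fun _ : Fin (m + 1) => ν) ≤
      ∫⁻ b, (∫⁻ a, F i a ∂ν) * ∏ j, F (i.succAbove j) (b j)
        ∂(Measure.pi fun _ : Fin m => ν) := by
  obtain ⟨G, hGm, hGle, hGeq⟩ := exists_measurable_le_lintegral_eq
    (μ := Measure.pi fun _ : Fin (m + 1) => ν) (fun y => ∏ j, F j (y j))
  rw [hGeq]
  have hmp := measurePreserving_piFinSuccAbove (fun _ : Fin (m + 1) => ν) i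
  have hmp' := hmp.symm (MeasurableEquiv.piFinSuccAbove (fun _ : Fin (m + 1) => E) i)
  rw [← hmp'.lintegral_comp_emb (MeasurableEquiv.measurableEmbedding _) G]
  rw [lintegral_prod_symm' (fun z => G ((MeasurableEquiv.piFinSuccAbove (fun _ => E) i).symm z))
    (hGm.comp (MeasurableEquiv.measurable _))]
  refine lintegral_mono fun b => ?_
  rw [← lintegral_mul_const' _ _ (ENNReal.prod_ne_top fun j _ => hF _ _)]
  refine lintegral_mono fun a => ?_
  refine (hGle _).trans (le_of_eq ?_)
  change ∏ j, F j ((i.insertNth a b : Fin (m + 1) → E) j) = _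
  rw [Fin.prod_univ_succAbove _ i]
  simp

lemma lower_pi_le {E : Type*} [MeasurableSpace E] (ν : Measure E) [SigmaFinite ν] {m : ℕ}
    (F : Fin m → E → ℝ≥0∞) (hF : ∀ j x, F j x ≠ ∞) :
    ∫⁻ y, ∏ j, F j (y j) ∂(Measure.pi fun _ : Fin m => ν) ≤ ∏ j, ∫⁻ a, F j a ∂ν := by
  induction m with
  | zero => simp
  | succ m ih =>
    by_cases hz : ∃ i, ∫⁻ a, F i a ∂ν = 0
    · obtain ⟨i, hi⟩ := hz
      refine (lower_pi_step ν F i hF).trans ?_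
      simp [hi]
    push Not at hz
    by_cases ht : ∃ i, ∫⁻ a, F i a ∂ν = ∞
    · obtain ⟨i, hi⟩ := ht
      have : ∏ j, ∫⁻ a, F j a ∂ν = ∞ := by
        rw [Fin.prod_univ_succAbove _ i, hi, ENNReal.top_mul]
        exact Finset.prod_ne_zero_iff.2 fun j _ => hz _
      rw [this]; exact le_top
    push Not at ht
    refine (lower_pi_step ν F 0 hF).trans ?_
    rw [lintegral_const_mul' _ _ (ht 0), Fin.prod_univ_succAbove _ 0]
    gcongr
    exact ih _ fun j x => hF _ x

lemma fracIntegral_le (hn : 0 < n) {m : ℕ} (hm : 0 < m) {α : ℝ} (hα : α < (m : ℝ) * n)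
    (f : Fin m → (Fin n → ℝ) → ℝ) (x : Fin n → ℝ) :
    fracIntegral α f x ≤ (2 : ℝ≥0∞) ^ ((m : ℝ) * n - α) *
      ∑' k : ℤ, pw k (α - (m : ℝ) * n) *
        ∏ j, ∫⁻ y in Metric.closedBall x ((2 : ℝ) ^ k), ENNReal.ofReal |f j y| := by
  have : Nonempty (Fin n) := ⟨⟨0, hn⟩⟩
  have : Nonempty (Fin m) := ⟨⟨0, hm⟩⟩
  set γ : ℝ := (m : ℝ) * n - α with hγ
  have hγ0 : 0 < γ := by linarith
  set xx : Fin m → Fin n → ℝ := fun _ => x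
  let S : ℤ → Set (Fin m → Fin n → ℝ) := fun k => {y | (2:ℝ) ^ k ≤ dist y xx ∧ dist y xx < 2 ^ (k + 1)}
  have hcover : ({xx}ᶜ : Set (Fin m → Fin n → ℝ)) ⊆ ⋃ k, S k := by
    intro y hy
    have : 0 < dist y xx := dist_pos.2 hy
    obtain ⟨k, h1, h2⟩ := exists_mem_Ico_zpow this (y := (2:ℝ)) (by norm_num)
    exact Set.mem_iUnion.2 ⟨k, h1, h2⟩
  unfold fracIntegral
  have hae : ∀ (g : (Fin m → Fin n → ℝ) → ℝ≥0∞), ∫⁻ y, g y = ∫⁻ y in ({xx}ᶜ : Set _), g y := by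
    intro g
    rw [← setLIntegral_univ]
    refine setLIntegral_congr ?_
    symm
    rw [ae_eq_univ, compl_compl]
    exact measure_singleton _
  rw [hae]
  refine (lintegral_mono_set hcover).trans ?_
  refine (lintegral_iUnion_le S _).trans ?_
  have hterm : ∀ k : ℤ, ∫⁻ y in S k, (∏ j, ENNReal.ofReal |f j (y j)|) /
      ENNReal.ofReal ((∑ j, Real.sqrt (∑ i, (x i - y j i) ^ 2)) ^ γ) ≤
      2 ^ γ * (pw (k+1) (α - (m : ℝ) * n) *
        ∏ j, ∫⁻ y in Metric.closedBall x ((2 : ℝ) ^ (k+1)), ENNReal.ofReal |f j y|) := by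
    intro k
    have hSm : MeasurableSet (S k) := by
      apply MeasurableSet.inter
      · exact measurableSet_le measurable_const (measurable_id.dist measurable_const)
      · exact measurableSet_lt (measurable_id.dist measurable_const) measurable_const
    have h1 : ∀ y ∈ S k, (∏ j, ENNReal.ofReal |f j (y j)|) /
      ENNReal.ofReal ((∑ j, Real.sqrt (∑ i, (x i - y j i) ^ 2)) ^ γ) ≤
        pw k (-γ) * ∏ j, ENNReal.ofReal |f j (y j)| := by
      intro y hy
      have hd : dist y xx ≤ ∑ j, Real.sqrt (∑ i, (x i - y j i) ^ 2) := by
        refine (dist_pi_le_iff (Finset.sum_nonneg fun j _ => Real.sqrt_nonneg _)).2 fun j => ?_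
        refine le_trans ?_ (Finset.single_le_sum (f := fun j => Real.sqrt (∑ i, (x i - y j i) ^ 2))
          (fun j _ => Real.sqrt_nonneg _) (Finset.mem_univ j))
        refine (dist_pi_le_iff (Real.sqrt_nonneg _)).2 fun i => ?_
        rw [dist_comm, Real.dist_eq]
        refine Real.abs_le_sqrt ?_
        exact Finset.single_le_sum (f := fun i => (x i - y j i) ^ 2)
          (fun i _ => sq_nonneg _) (Finset.mem_univ i)
      have hd2 : (2:ℝ) ^ k ≤ ∑ j, Real.sqrt (∑ i, (x i - y j i) ^ 2) := hy.1.trans hd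
      rw [ENNReal.div_eq_inv_mul]
      gcongr
      have : pw k (-γ) = (ENNReal.ofReal (((2:ℝ) ^ k) ^ γ))⁻¹ := by
        rw [← ENNReal.ofReal_rpow_of_pos (by positivity), ← pw_one_eq_ofReal, ← ENNReal.rpow_neg,
          ← pw_eq_one_rpow]
      rw [this]
      gcongr
    refine (setLIntegral_mono' hSm h1).trans ?_
    rw [lintegral_const_mul' _ _ (pw_ne_top _ _), ← mul_assoc]
    have hc : 2 ^ γ * pw (k+1) (α - (m : ℝ) * n) = pw k (-γ) := by
      have : α - (m : ℝ) * n = -γ := by rw [hγ]; ring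
      rw [this, pw_succ, ← mul_assoc, ← ENNReal.rpow_add _ _ (by norm_num) (by norm_num)]
      simp
    rw [hc]
    gcongr
    have hsub : S k ⊆ Set.univ.pi fun _ : Fin m => Metric.closedBall x ((2 : ℝ) ^ (k+1)) := by
      intro y hy j _
      exact (dist_le_pi_dist y xx j).trans hy.2.le
    refine (lintegral_mono_set hsub).trans ?_
    have hv : (volume : Measure (Fin m → Fin n → ℝ)) = Measure.pi fun _ => volume := rfl
    rw [hv, Measure.restrict_pi_pi]
    exact lower_pi_le _ (fun j y => ENNReal.ofReal |f j y|) fun _ _ => ENNReal.ofReal_ne_top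
  refine (ENNReal.tsum_le_tsum hterm).trans ?_
  rw [ENNReal.tsum_mul_left]
  refine mul_le_mul_right ?_ _
  exact le_of_eq ((Equiv.addRight (1:ℤ)).tsum_eq (fun k : ℤ => pw k (α - (m : ℝ) * n) *
        ∏ j, ∫⁻ y in Metric.closedBall x ((2 : ℝ) ^ k), ENNReal.ofReal |f j y|))
lemma cube_eq_pi (a : Fin n → ℝ) (r : ℝ) :
    cube a r = Set.univ.pi fun i => Set.Ico (a i) (a i + r) := by
  ext y; simp [cube, Set.mem_pi]

lemma measurableSet_cube (a : Fin n → ℝ) (r : ℝ) : MeasurableSet (cube a r) := by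
  rw [cube_eq_pi]
  exact MeasurableSet.univ_pi fun i => measurableSet_Ico

lemma volume_cube (a : Fin n → ℝ) (r : ℝ) :
    volume (cube a r) = ENNReal.ofReal r ^ (n : ℝ) := by
  rw [cube_eq_pi, Real.volume_pi_Ico]
  simp

lemma closedBall_subset_cube (x : Fin n → ℝ) {r : ℝ} (hr : 0 < r) :
    Metric.closedBall x r ⊆ cube (fun i => x i - r) (3 * r) := by
  intro y hy i
  have := (dist_le_pi_dist y x i).trans hy
  rw [Real.dist_eq, abs_le] at this
  constructor <;> linarith

lemma closedBall_subset_triple (a : Fin n → ℝ) {r s : ℝ} (hsr : s ≤ r) {x : Fin n → ℝ}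
    (hx : x ∈ cube a r) :
    Metric.closedBall x s ⊆ cube (fun i => a i - r) (3 * r) := by
  intro y hy i
  have := (dist_le_pi_dist y x i).trans hy
  rw [Real.dist_eq, abs_le] at this
  have h2 := hx i
  constructor <;> linarith

lemma volume_closedBall_two (x : Fin n → ℝ) (k : ℤ) :
    volume (Metric.closedBall x ((2:ℝ) ^ k)) = 2 ^ n * pw k n := by
  rw [Real.volume_pi_closedBall _ (by positivity), Fintype.card_fin,
    ENNReal.ofReal_pow (by positivity), ENNReal.ofReal_mul (by norm_num), ← pw_one_eq_ofReal,
    mul_pow, ← ENNReal.rpow_natCast (pw k 1), ← pw_eq_one_rpow]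
  simp

/-- normalized average -/
def avgN (h : (Fin n → ℝ) → ℝ≥0∞) (k : ℤ) (x : Fin n → ℝ) : ℝ≥0∞ :=
  pw k (-(n : ℝ)) * ∫⁻ y in Metric.closedBall x ((2 : ℝ) ^ k), h y

lemma measurable_ball_integral {h : (Fin n → ℝ) → ℝ≥0∞} (hh : Measurable h) (r : ℝ) :
    Measurable fun x => ∫⁻ y in Metric.closedBall x r, h y := by
  have : (fun x => ∫⁻ y in Metric.closedBall x r, h y) =
      fun x => ∫⁻ y, ({z : (Fin n → ℝ) × (Fin n → ℝ) | dist z.2 z.1 ≤ r}.indicator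
        (fun z => h z.2) (x, y)) := by
    ext x
    rw [← lintegral_indicator Metric.isClosed_closedBall.measurableSet]
    rfl
  rw [this]
  apply Measurable.lintegral_prod_right
  apply Measurable.indicator (hh.comp measurable_snd)
  exact measurableSet_le (measurable_snd.dist measurable_fst) measurable_const

lemma measurable_avgN {h : (Fin n → ℝ) → ℝ≥0∞} (hh : Measurable h) (k : ℤ) :
    Measurable (avgN h k) :=
  (measurable_ball_integral hh _).const_mul _

lemma measurable_avgN_uncurry {h : (Fin n → ℝ) → ℝ≥0∞} (hh : Measurable h) :
    Measurable (fun z : ℤ × (Fin n → ℝ) => avgN h z.1 z.2) :=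
  measurable_from_prod_countable_right fun k => measurable_avgN hh k

/-- The Carleson measure. -/
def carl (μ : Measure (Fin n → ℝ)) (e : ℝ) (K : ℤ) : Measure (ℤ × (Fin n → ℝ)) :=
  Measure.sum fun k : ℤ => (if k ≤ K then pw k e else 0) • μ.map (fun x => (k, x))

lemma lintegral_carl (μ : Measure (Fin n → ℝ)) (e : ℝ) (K : ℤ)
    {G : ℤ × (Fin n → ℝ) → ℝ≥0∞} (hG : Measurable G) :
    ∫⁻ z, G z ∂(carl μ e K) = ∑' k : ℤ, (if k ≤ K then pw k e else 0) * ∫⁻ x, G (k, x) ∂μ := by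
  unfold carl
  rw [lintegral_sum_measure]
  refine tsum_congr fun k => ?_
  rw [lintegral_smul_measure, lintegral_map hG (by fun_prop)]
  rfl

lemma carl_apply (μ : Measure (Fin n → ℝ)) (e : ℝ) (K : ℤ)
    {S : Set (ℤ × (Fin n → ℝ))} (hS : MeasurableSet S) :
    carl μ e K S = ∑' k : ℤ, (if k ≤ K then pw k e else 0) * μ {x | (k, x) ∈ S} := by
  unfold carl
  rw [Measure.sum_apply _ hS]
  refine tsum_congr fun k => ?_
  rw [Measure.smul_apply, Measure.map_apply (by fun_prop) hS]
  rfl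

/-- constant in the weak type Carleson estimate -/
def weakC (n : ℕ) (e : ℝ) : ℝ≥0∞ := geoC e * 5 ^ e * 15 ^ ((n : ℝ) - e)

open Classical in
lemma carl_tent (μ : Measure (Fin n → ℝ)) {e : ℝ} (he : 0 < e) (hen : e < n) (K : ℤ) (M : ℝ≥0∞)
    (hμ : ∀ a r, 0 < r → μ (cube a r) ≤ M * ENNReal.ofReal r ^ ((n : ℝ) - e))
    (k₀ : ℤ) (c : Fin n → ℝ) :
    carl μ e K ({k : ℤ | pw k 1 ≤ 5 * pw k₀ 1} ×ˢ Metric.closedBall c (5 * 2 ^ k₀)) ≤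
      weakC n e * M * pw k₀ n := by
  have hb : μ (Metric.closedBall c (5 * 2 ^ k₀)) ≤ M * (15 * pw k₀ 1) ^ ((n : ℝ) - e) := by
    refine (measure_mono (closedBall_subset_cube c (by positivity))).trans ?_
    refine (hμ _ _ (by positivity)).trans (le_of_eq ?_)
    rw [← mul_assoc, ENNReal.ofReal_mul (by norm_num), ← pw_one_eq_ofReal]
    norm_num
  rw [carl_apply _ _ _ ((MeasurableSet.of_discrete).prod Metric.isClosed_closedBall.measurableSet)]
  calc _ ≤ ∑' k : ℤ, (if pw k 1 ≤ 5 * pw k₀ 1 then pw k e else 0) *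
        (M * (15 * pw k₀ 1) ^ ((n : ℝ) - e)) := by
        refine ENNReal.tsum_le_tsum fun k => ?_
        by_cases hk : pw k 1 ≤ 5 * pw k₀ 1
        · rw [if_pos hk]
          gcongr
          · split_ifs <;> simp
          · refine (measure_mono ?_).trans hb
            intro x hx; exact hx.2
        · have : {x : Fin n → ℝ | (k, x) ∈ {k : ℤ | pw k 1 ≤ 5 * pw k₀ 1} ×ˢ
              Metric.closedBall c (5 * 2 ^ k₀)} = ∅ := by
            ext x; simp [hk]
          rw [this]; simp
    _ ≤ geoC e * (5 * pw k₀ 1) ^ e * (M * (15 * pw k₀ 1) ^ ((n : ℝ) - e)) := by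
        rw [ENNReal.tsum_mul_right]
        gcongr
        exact geo_le he _
    _ = _ := by
        have : pw k₀ n = pw k₀ 1 ^ e * pw k₀ 1 ^ ((n:ℝ) - e) := by
          rw [← pw_eq_one_rpow, ← pw_eq_one_rpow, ← pw_add]; congr 1; ring
        rw [this, ENNReal.mul_rpow_of_nonneg _ _ he.le, ENNReal.mul_rpow_of_nonneg _ _ (by linarith)]
        unfold weakC; ring

lemma carl_weak (hn : 0 < n) (μ : Measure (Fin n → ℝ)) {e : ℝ} (he : 0 < e) (hen : e < n) (K : ℤ)
    (M : ℝ≥0∞)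
    (hμ : ∀ a r, 0 < r → μ (cube a r) ≤ M * ENNReal.ofReal r ^ ((n : ℝ) - e))
    (h : (Fin n → ℝ) → ℝ≥0∞) (t : ℝ≥0∞) :
    carl μ e K {z | t ≤ avgN h z.1 z.2} * t ≤ weakC n e * M * ∫⁻ y, h y := by
  set W : Set (ℤ × (Fin n → ℝ)) := {z | z.1 ≤ K ∧ t ≤ avgN h z.1 z.2} with hW
  have hzero : carl μ e K ({k : ℤ | K < k} ×ˢ Set.univ) = 0 := by
    rw [carl_apply _ _ _ ((MeasurableSet.of_discrete).prod MeasurableSet.univ)]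
    rw [ENNReal.tsum_eq_zero]
    intro k
    by_cases hk : k ≤ K
    · have : {x : Fin n → ℝ | (k, x) ∈ {k : ℤ | K < k} ×ˢ (Set.univ : Set (Fin n → ℝ))} = ∅ := by
        ext x; simp [hk]
      rw [this]; simp
    · simp [hk]
  have hWle : carl μ e K {z | t ≤ avgN h z.1 z.2} ≤ carl μ e K W := by
    calc _ ≤ carl μ e K (W ∪ ({k : ℤ | K < k} ×ˢ Set.univ)) := by
          apply measure_mono
          intro z hz
          by_cases hk : z.1 ≤ K
          · left; exact ⟨hk, hz⟩
          · right; simpa using hk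
      _ ≤ _ := (measure_union_le _ _).trans (by rw [hzero, add_zero])
  obtain ⟨u, huW, hdisj, hcov⟩ := Vitali.exists_disjoint_subfamily_covering_enlargement_closedBall
    W (fun z => z.2) (fun z => (2:ℝ) ^ z.1) (2 ^ K)
    (fun z hz => zpow_le_zpow_right₀ (by norm_num) hz.1) 5 (by norm_num)
  have hucount : u.Countable := hdisj.countable_of_nonempty_interior fun z _ =>
    ⟨z.2, by
      refine interior_maximal Metric.ball_subset_closedBall Metric.isOpen_ball ?_
      exact Metric.mem_ball_self (by positivity)⟩
  have hsub : W ⊆ ⋃ b ∈ u, ({k : ℤ | pw k 1 ≤ 5 * pw b.1 1} ×ˢ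
      Metric.closedBall b.2 (5 * (2:ℝ) ^ b.1)) := by
    intro z hz
    obtain ⟨b, hb, hzb⟩ := hcov z hz
    refine Set.mem_iUnion₂.2 ⟨b, hb, ?_, ?_⟩
    · have hv := measure_mono (μ := volume) hzb
      rw [Real.volume_pi_closedBall _ (by positivity), Real.volume_pi_closedBall _ (by positivity),
        ENNReal.ofReal_le_ofReal_iff (by positivity), Fintype.card_fin,
        pow_le_pow_iff_left₀ (by positivity) (by positivity) hn.ne'] at hv
      have hv' : (2:ℝ) ^ z.1 ≤ 5 * 2 ^ b.1 := by linarith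
      have := ENNReal.ofReal_le_ofReal hv'
      rw [ENNReal.ofReal_mul (by norm_num), ← pw_one_eq_ofReal, ← pw_one_eq_ofReal] at this
      simpa using this
    · exact hzb (Metric.mem_closedBall_self (by positivity))
  have : Countable u := hucount
  calc carl μ e K {z | t ≤ avgN h z.1 z.2} * t
      ≤ (∑' b : u, carl μ e K ({k : ℤ | pw k 1 ≤ 5 * pw b.1.1 1} ×ˢ
          Metric.closedBall b.1.2 (5 * (2:ℝ) ^ b.1.1))) * t := by
        gcongr
        refine hWle.trans ((measure_mono hsub).trans ?_)
        exact measure_biUnion_le _ hucount _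
    _ = ∑' b : u, carl μ e K ({k : ℤ | pw k 1 ≤ 5 * pw b.1.1 1} ×ˢ
          Metric.closedBall b.1.2 (5 * (2:ℝ) ^ b.1.1)) * t := by rw [ENNReal.tsum_mul_right]
    _ ≤ ∑' b : u, weakC n e * M * ∫⁻ y in Metric.closedBall b.1.2 ((2:ℝ) ^ b.1.1), h y := by
        refine ENNReal.tsum_le_tsum fun b => ?_
        calc _ ≤ weakC n e * M * pw b.1.1 n * avgN h b.1.1 b.1.2 := by
              gcongr
              · exact carl_tent μ he hen K M hμ _ _
              · exact (huW b.2).2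
          _ = weakC n e * M * ((pw b.1.1 n * pw b.1.1 (-n)) *
                ∫⁻ y in Metric.closedBall b.1.2 ((2:ℝ) ^ b.1.1), h y) := by
              unfold avgN; ring
          _ = _ := by rw [← pw_add, add_neg_cancel, pw_zero, one_mul]
    _ = weakC n e * M * ∫⁻ y in ⋃ b ∈ u, Metric.closedBall b.2 ((2:ℝ) ^ b.1), h y := by
        rw [ENNReal.tsum_mul_left, lintegral_biUnion hucount
          (fun b _ => Metric.isClosed_closedBall.measurableSet) hdisj]
    _ ≤ _ := by
        exact mul_le_mul_right (setLIntegral_le_lintegral _ _) _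

/-- constant in the strong type Carleson estimate -/
def strongC (n : ℕ) (e s : ℝ) : ℝ≥0∞ :=
  2 ^ s * (2 * weakC n e * (geoC (s - 1) * (2 ^ (n + 1)) ^ (s - 1)))

open Classical in
lemma carl_strong (hn : 0 < n) (μ : Measure (Fin n → ℝ)) {e : ℝ} (he : 0 < e) (hen : e < n) (K : ℤ)
    (M : ℝ≥0∞)
    (hμ : ∀ a r, 0 < r → μ (cube a r) ≤ M * ENNReal.ofReal r ^ ((n : ℝ) - e))
    {s : ℝ} (hs : 1 < s) {h : (Fin n → ℝ) → ℝ≥0∞} (hh : Measurable h) :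
    ∫⁻ z, avgN h z.1 z.2 ^ s ∂(carl μ e K) ≤ strongC n e s * M * ∫⁻ y, h y ^ s := by
  have hA := measurable_avgN_uncurry hh
  have hset : ∀ i : ℤ, MeasurableSet {z : ℤ × (Fin n → ℝ) | pw i 1 ≤ avgN h z.1 z.2} :=
    fun i => measurableSet_le measurable_const hA
  let S : ℤ → Set (Fin n → ℝ) := fun i => {y | pw i 1 ≤ 2 ^ (n + 1) * h y}
  have hSm : ∀ i, MeasurableSet (S i) := fun i => measurableSet_le measurable_const (hh.const_mul _)
  have hlevel : ∀ i : ℤ, carl μ e K {z | pw i 1 ≤ avgN h z.1 z.2} * pw i 1 ≤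
      2 * weakC n e * M * ∫⁻ y, (S i).indicator h y := by
    intro i
    have hsub : {z : ℤ × (Fin n → ℝ) | pw i 1 ≤ avgN h z.1 z.2} ⊆
        {z | pw i 1 / 2 ≤ avgN ((S i).indicator h) z.1 z.2} := by
      intro z hz
      have hle : ∀ y, h y ≤ (S i).indicator h y + pw i 1 / 2 ^ (n+1) := by
        intro y
        by_cases hy : y ∈ S i
        · rw [Set.indicator_of_mem hy]; exact le_self_add
        · rw [Set.indicator_of_notMem hy, zero_add]
          have : 2 ^ (n+1) * h y < pw i 1 := not_le.1 hy
          rw [ENNReal.le_div_iff_mul_le (by simp) (by simp), mul_comm]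
          exact this.le
      have h1 : avgN h z.1 z.2 ≤ avgN ((S i).indicator h) z.1 z.2 + pw i 1 / 2 := by
        unfold avgN
        calc _ ≤ pw z.1 (-(n:ℝ)) * ∫⁻ y in Metric.closedBall z.2 ((2:ℝ) ^ z.1),
              ((S i).indicator h y + pw i 1 / 2 ^ (n+1)) := by
              gcongr with y; exact hle y
          _ = pw z.1 (-(n:ℝ)) * (∫⁻ y in Metric.closedBall z.2 ((2:ℝ) ^ z.1),
              (S i).indicator h y) + (pw z.1 (-(n:ℝ)) * pw z.1 n) * (pw i 1 / 2 ^ (n+1) * 2 ^ n) := by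
              rw [lintegral_add_right _ measurable_const, setLIntegral_const,
                volume_closedBall_two]
              ring
          _ = _ := by
              rw [← pw_add, neg_add_cancel, pw_zero, one_mul]
              congr 1
              rw [pow_succ, div_eq_mul_inv, div_eq_mul_inv, ENNReal.mul_inv (by simp) (by simp)]
              rw [mul_assoc, mul_assoc, mul_comm _ ((2:ℝ≥0∞) ^ n), ← mul_assoc ((2:ℝ≥0∞) ^ n)⁻¹,
                mul_comm, mul_comm]
              rw [ENNReal.inv_mul_cancel (by simp) (by simp), one_mul]
      have h2 : pw i 1 / 2 + pw i 1 / 2 ≤ avgN ((S i).indicator h) z.1 z.2 + pw i 1 / 2 := by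
        rw [ENNReal.add_halves]; exact le_trans hz h1
      exact (ENNReal.add_le_add_iff_right
        (ENNReal.div_ne_top (pw_ne_top _ _) (by norm_num))).1 h2
    have hw := carl_weak hn μ he hen K M hμ ((S i).indicator h) (pw i 1 / 2)
    calc _ = 2 * (carl μ e K {z | pw i 1 ≤ avgN h z.1 z.2} * (pw i 1 / 2)) := by
          have h2 : pw i 1 = 2 * (pw i 1 / 2) := by rw [two_mul, ENNReal.add_halves]
          generalize carl μ e K {z | pw i 1 ≤ avgN h z.1 z.2} = X
          conv_lhs => rw [h2]
          ring
      _ ≤ 2 * (weakC n e * M * ∫⁻ y, (S i).indicator h y) := by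
          refine mul_le_mul_right (le_trans ?_ hw) _
          exact mul_le_mul_left (measure_mono hsub) _
      _ = _ := by ring
  calc ∫⁻ z, avgN h z.1 z.2 ^ s ∂(carl μ e K)
      ≤ ∫⁻ z, 2 ^ s * ∑' i : ℤ, ({z | pw i 1 ≤ avgN h z.1 z.2}.indicator (fun _ => pw i s) z)
          ∂(carl μ e K) := by
        refine lintegral_mono fun z => ?_
        refine (rpow_le_tsum _ (by linarith)).trans (le_of_eq ?_)
        congr 1
        refine tsum_congr fun i => ?_
        simp [Set.indicator_apply]
    _ = 2 ^ s * ∑' i : ℤ, pw i s * carl μ e K {z | pw i 1 ≤ avgN h z.1 z.2} := by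
        rw [lintegral_const_mul' _ _ (ENNReal.rpow_ne_top_of_nonneg (by linarith) (by norm_num)),
          lintegral_tsum fun i => (measurable_const.indicator (hset i)).aemeasurable]
        congr 1
        refine tsum_congr fun i => ?_
        rw [lintegral_indicator_const (hset i)]
    _ ≤ 2 ^ s * ∑' i : ℤ, 2 * weakC n e * M * ∫⁻ y, pw i (s - 1) * (S i).indicator h y := by
        refine mul_le_mul_right (ENNReal.tsum_le_tsum fun i => ?_) _
        have : pw i s = pw i 1 * pw i (s - 1) := by rw [← pw_add]; congr 1; ring
        rw [this, lintegral_const_mul' _ _ (pw_ne_top _ _)]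
        calc _ = pw i (s-1) * (carl μ e K {z | pw i 1 ≤ avgN h z.1 z.2} * pw i 1) := by ring
          _ ≤ pw i (s-1) * (2 * weakC n e * M * ∫⁻ y, (S i).indicator h y) := by
            exact mul_le_mul_right (hlevel i) _
          _ = _ := by ring
    _ = 2 ^ s * (2 * weakC n e * M * ∫⁻ y, ∑' i : ℤ, pw i (s - 1) * (S i).indicator h y) := by
        rw [ENNReal.tsum_mul_left, lintegral_tsum]
        exact fun i => ((hh.indicator (hSm i)).const_mul _).aemeasurable
    _ ≤ 2 ^ s * (2 * weakC n e * M * ∫⁻ y, geoC (s - 1) * (2 ^ (n + 1)) ^ (s - 1) * h y ^ s) := by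
        gcongr with y
        calc ∑' i : ℤ, pw i (s - 1) * (S i).indicator h y
            = (∑' i : ℤ, if pw i 1 ≤ 2 ^ (n + 1) * h y then pw i (s-1) else 0) * h y := by
              rw [← ENNReal.tsum_mul_right]
              refine tsum_congr fun i => ?_
              by_cases hy : pw i 1 ≤ 2 ^ (n + 1) * h y
              · rw [if_pos hy, Set.indicator_of_mem (show y ∈ S i from hy)]
              · rw [if_neg hy, Set.indicator_of_notMem (show y ∉ S i from hy)]; simp
          _ ≤ geoC (s - 1) * (2 ^ (n + 1) * h y) ^ (s - 1) * h y := by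
              gcongr
              exact geo_le (by linarith) _
          _ = geoC (s - 1) * (2 ^ (n + 1)) ^ (s - 1) * (h y ^ (s - 1) * h y ^ (1:ℝ)) := by
              rw [ENNReal.mul_rpow_of_nonneg _ _ (by linarith), ENNReal.rpow_one]; ring
          _ = _ := by
              rw [← ENNReal.rpow_add_of_nonneg _ _ (by linarith) (by norm_num)]
              congr 2; ring
    _ = _ := by
        rw [lintegral_const_mul _ (hh.pow_const s)]
        unfold strongC; ring
lemma prod_rpow_const {ι : Type*} (s : Finset ι) (x : ℝ≥0∞) (a : ι → ℝ) (ha : ∀ i ∈ s, 0 ≤ a i) :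
    ∏ i ∈ s, x ^ a i = x ^ (∑ i ∈ s, a i) := by
  classical
  induction s using Finset.induction with
  | empty => simp
  | insert i s hi ih =>
    rw [Finset.prod_insert hi, Finset.sum_insert hi, ih fun j hj => ha j (Finset.mem_insert_of_mem hj),
      ENNReal.rpow_add_of_nonneg _ _ (ha i (Finset.mem_insert_self _ _))
        (Finset.sum_nonneg fun j hj => ha j (Finset.mem_insert_of_mem hj))]

lemma holder_one {E : Type*} [MeasurableSpace E] (ν : Measure E) {P : ℝ} (hP : 1 < P)
    {g : E → ℝ≥0∞} (hg : Measurable g) :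
    ∫⁻ y, g y ∂ν ≤ (∫⁻ y, g y ^ P ∂ν) ^ (1 / P) * ν Set.univ ^ (1 - 1 / P) := by
  have hc : P.HolderConjugate (P.conjExponent) := Real.HolderConjugate.conjExponent hP
  have h := ENNReal.lintegral_mul_le_Lp_mul_Lq ν hc hg.aemeasurable
    (measurable_const (a := (1 : ℝ≥0∞))).aemeasurable
  have h2 : 1 / P.conjExponent = 1 - 1 / P := by
    have := hc.inv_add_inv_eq_one
    simp only [one_div]; linarith
  rw [h2] at h
  simpa using h

section main

variable {m : ℕ} {P : Fin m → ℝ} {p p0 : ℝ} {g : Fin m → (Fin n → ℝ) → ℝ≥0∞} {N : ℝ≥0∞}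

/-- product of ball integrals -/
def ballProd (g : Fin m → (Fin n → ℝ) → ℝ≥0∞) (k : ℤ) (x : Fin n → ℝ) : ℝ≥0∞ :=
  ∏ j, ∫⁻ y in Metric.closedBall x ((2 : ℝ) ^ k), g j y

/-- the dyadic-scale potential -/
def pot (γ : ℝ) (g : Fin m → (Fin n → ℝ) → ℝ≥0∞) (x : Fin n → ℝ) : ℝ≥0∞ :=
  ∑' k : ℤ, pw k (γ - (m : ℝ) * n) * ballProd g k x

lemma measurable_ballProd (hg : ∀ j, Measurable (g j)) (k : ℤ) : Measurable (ballProd g k) :=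
  Finset.measurable_fun_prod _ fun j _ => measurable_ball_integral (hg j) _

lemma measurable_pot (γ : ℝ) (hg : ∀ j, Measurable (g j)) : Measurable (pot γ g) :=
  Measurable.tsum fun k => (measurable_ballProd hg k).const_mul _

/-- constant -/
def bC (n m : ℕ) (p0 : ℝ) : ℝ≥0∞ := 3 ^ ((m : ℝ) * n - n / p0)

lemma ballProd_le (hP : ∀ j, 1 < P j) (hp : 1 / p = ∑ j, 1 / P j)
    (hg : ∀ j, Measurable (g j))
    (hN : ∀ a r, 0 < r → ∏ j, (∫⁻ x in cube a r, g j x ^ P j) ^ (1 / P j) ≤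
      N * ENNReal.ofReal r ^ ((n : ℝ) * (1 / p - 1 / p0)))
    (k : ℤ) (x : Fin n → ℝ) :
    ballProd g k x ≤ bC n m p0 * N * pw k ((m : ℝ) * n - n / p0) := by
  have h2 : (0 : ℝ) < 3 * 2 ^ k := by positivity
  set C := cube (fun i => x i - 2 ^ k) (3 * 2 ^ k) with hC
  set ρ := ENNReal.ofReal (3 * 2 ^ k) with hρ
  have hρ0 : ρ ≠ 0 := by simpa [hρ] using h2
  have hρt : ρ ≠ ∞ := ENNReal.ofReal_ne_top
  have h3 : ρ = 3 * pw k 1 := by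
    rw [hρ, ENNReal.ofReal_mul (by norm_num), ← pw_one_eq_ofReal]; simp
  calc ballProd g k x ≤ ∏ j, ((∫⁻ y in C, g j y ^ P j) ^ (1 / P j) * ρ ^ ((n : ℝ) * (1 - 1 / P j))) := by
        unfold ballProd
        refine Finset.prod_le_prod' fun j _ => ?_
        refine (lintegral_mono_set (closedBall_subset_cube x (by positivity))).trans ?_
        refine (holder_one (volume.restrict C) (hP j) (hg j)).trans (le_of_eq ?_)
        rw [Measure.restrict_apply_univ, hC, volume_cube, ENNReal.rpow_mul]
    _ = (∏ j, (∫⁻ y in C, g j y ^ P j) ^ (1 / P j)) * ρ ^ (∑ j, (n : ℝ) * (1 - 1 / P j)) := by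
        rw [Finset.prod_mul_distrib, prod_rpow_const]
        intro j _
        have : 1 / P j ≤ 1 := by
          rw [div_le_one (by linarith [hP j])]; exact (hP j).le
        have : 0 ≤ 1 - 1 / P j := by linarith
        positivity
    _ ≤ N * ρ ^ ((n : ℝ) * (1 / p - 1 / p0)) * ρ ^ (∑ j, (n : ℝ) * (1 - 1 / P j)) := by
        gcongr
        exact hN _ _ h2
    _ = N * ρ ^ ((m : ℝ) * n - n / p0) := by
        rw [mul_assoc, ← ENNReal.rpow_add _ _ hρ0 hρt]
        congr 2
        rw [← Finset.mul_sum, Finset.sum_sub_distrib, ← hp]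
        simp
        ring
    _ = _ := by
        rw [h3, ENNReal.mul_rpow_of_ne_top (by simp) (pw_ne_top _ _), ← pw_eq_one_rpow]
        unfold bC; ring

/-- constant for the near part -/
def nearC (n : ℕ) (P : Fin m → ℝ) (p p0 e : ℝ) : ℝ≥0∞ :=
  (∏ j, strongC n e (P j) ^ (p / P j)) * (3 ^ ((n : ℝ) * (1 / p - 1 / p0))) ^ p

open Classical in
lemma near_le (hn : 0 < n) (hP : ∀ j, 1 < P j) (hp : 1 / p = ∑ j, 1 / P j) (hp0 : 0 < p)
    (hg : ∀ j, Measurable (g j))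
    (hN : ∀ a r, 0 < r → ∏ j, (∫⁻ x in cube a r, g j x ^ P j) ^ (1 / P j) ≤
      N * ENNReal.ofReal r ^ ((n : ℝ) * (1 / p - 1 / p0)))
    {β : ℝ} (hβ : 0 < β) (hβn : β * p < n)
    (μ : Measure (Fin n → ℝ)) (M : ℝ≥0∞)
    (hμ : ∀ a r, 0 < r → μ (cube a r) ≤ M * ENNReal.ofReal r ^ ((n : ℝ) - β * p))
    (a : Fin n → ℝ) (r : ℝ) (hr : 0 < r) :
    ∫⁻ x in cube a r, (∑' k : ℤ, if pw k 1 ≤ ENNReal.ofReal r then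
        (pw k (β - (m : ℝ) * n) * ballProd g k x) ^ p else 0) ∂μ ≤
      nearC n P p p0 (β * p) * M * N ^ p * ENNReal.ofReal r ^ ((n : ℝ) * (1 - p / p0)) := by
  have hr0 : ENNReal.ofReal r ≠ 0 := by simpa using hr
  obtain ⟨K, hK1, hK2⟩ := ENNReal.exists_mem_Ico_zpow hr0 (ENNReal.ofReal_ne_top (r := r)) (y := 2)
    (by norm_num) (by norm_num)
  rw [← pw_one_eq_zpow] at hK1 hK2
  set Q3 := cube (fun i => a i - r) (3 * r) with hQ3
  have hQ3m : MeasurableSet Q3 := measurableSet_cube _ _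
  let h : Fin m → (Fin n → ℝ) → ℝ≥0∞ := fun j => Q3.indicator (g j)
  have hh : ∀ j, Measurable (h j) := fun j => (hg j).indicator hQ3m
  have hsum1 : ∑ j, p / P j = 1 := by
    have : ∀ j, p / P j = p * (1 / P j) := fun j => by ring
    simp_rw [this]
    rw [← Finset.mul_sum, ← hp]; field_simp
  have hnn : ∀ j ∈ Finset.univ, 0 ≤ p / P j := fun j _ => by
    have := hP j; positivity
  have hpt : ∀ x ∈ cube a r, (∑' k : ℤ, if pw k 1 ≤ ENNReal.ofReal r then
        (pw k (β - (m : ℝ) * n) * ballProd g k x) ^ p else 0) ≤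
        ∑' k : ℤ, (if k ≤ K then pw k (β * p) else 0) * ∏ j, avgN (h j) k x ^ p := by
    intro x hx
    refine ENNReal.tsum_le_tsum fun k => ?_
    by_cases hk : pw k 1 ≤ ENNReal.ofReal r
    · have hkK : k ≤ K := by
        by_contra! hh
        exact absurd ((pw_one_mono (show K + 1 ≤ k by omega)).trans hk) (not_le.2 hK2)
      rw [if_pos hk, if_pos hkK]
      have hk' : (2:ℝ) ^ k ≤ r := by
        rw [pw_one_eq_ofReal] at hk
        exact (ENNReal.ofReal_le_ofReal_iff hr.le).1 hk
      have hb : ∀ j, ∫⁻ y in Metric.closedBall x ((2 : ℝ) ^ k), g j y =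
          ∫⁻ y in Metric.closedBall x ((2 : ℝ) ^ k), h j y := by
        intro j
        refine setLIntegral_congr_fun Metric.isClosed_closedBall.measurableSet fun y hy => ?_
        exact (Set.indicator_of_mem (closedBall_subset_triple a hk' hx hy) _).symm
      have : pw k (β - (m : ℝ) * n) * ballProd g k x = pw k β * ∏ j, avgN (h j) k x := by
        unfold avgN ballProd
        rw [Finset.prod_mul_distrib, ← mul_assoc]
        congr 1
        · rw [Finset.prod_const, Finset.card_univ, Fintype.card_fin, ← ENNReal.rpow_natCast,
            pw_rpow, ← pw_add]
          congr 1; ring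
        · exact Finset.prod_congr rfl fun j _ => hb j
      rw [this, ENNReal.mul_rpow_of_nonneg _ _ hp0.le, pw_rpow,
        ENNReal.prod_rpow_of_nonneg hp0.le]
    · rw [if_neg hk]; exact zero_le
  have hGm : Measurable (fun z : ℤ × (Fin n → ℝ) => ∏ j, avgN (h j) z.1 z.2 ^ p) :=
    Finset.measurable_fun_prod _ fun j _ => (measurable_avgN_uncurry (hh j)).pow_const p
  calc _ ≤ ∫⁻ x in cube a r, (∑' k : ℤ, (if k ≤ K then pw k (β * p) else 0) *
          ∏ j, avgN (h j) k x ^ p) ∂μ := setLIntegral_mono' (measurableSet_cube _ _) hpt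
    _ ≤ ∫⁻ x, (∑' k : ℤ, (if k ≤ K then pw k (β * p) else 0) *
          ∏ j, avgN (h j) k x ^ p) ∂μ := setLIntegral_le_lintegral _ _
    _ = ∫⁻ z, ∏ j, avgN (h j) z.1 z.2 ^ p ∂(carl μ (β * p) K) := by
        rw [lintegral_carl _ _ _ hGm, lintegral_tsum]
        · refine tsum_congr fun k => ?_
          have hGk : Measurable fun x => ∏ j, avgN (h j) k x ^ p :=
            Finset.measurable_prod _ fun j _ => (measurable_avgN (hh j) k).pow_const p
          rw [lintegral_const_mul _ hGk]
        · intro k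
          have hGk : Measurable fun x => ∏ j, avgN (h j) k x ^ p :=
            Finset.measurable_prod _ fun j _ => (measurable_avgN (hh j) k).pow_const p
          exact (hGk.const_mul _).aemeasurable
    _ = ∫⁻ z, ∏ j, (avgN (h j) z.1 z.2 ^ P j) ^ (p / P j) ∂(carl μ (β * p) K) := by
        refine lintegral_congr fun z => Finset.prod_congr rfl fun j _ => ?_
        rw [← ENNReal.rpow_mul]
        congr 1
        have := hP j
        field_simp
    _ ≤ ∏ j, (∫⁻ z, avgN (h j) z.1 z.2 ^ P j ∂(carl μ (β * p) K)) ^ (p / P j) :=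
        ENNReal.lintegral_prod_norm_pow_le _
          (fun j _ => ((measurable_avgN_uncurry (hh j)).pow_const _).aemeasurable) hsum1 hnn
    _ ≤ ∏ j, (strongC n (β * p) (P j) * M * ∫⁻ y, h j y ^ P j) ^ (p / P j) := by
        refine Finset.prod_le_prod' fun j hj => ?_
        exact ENNReal.rpow_le_rpow (carl_strong hn μ (by positivity) hβn K M hμ (hP j) (hh j)) (hnn j hj)
    _ = (∏ j, strongC n (β * p) (P j) ^ (p / P j)) * M *
          (∏ j, (∫⁻ y in Q3, g j y ^ P j) ^ (1 / P j)) ^ p := by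
        have hintg : ∀ j, ∫⁻ y, h j y ^ P j = ∫⁻ y in Q3, g j y ^ P j := by
          intro j
          rw [← lintegral_indicator hQ3m]
          refine lintegral_congr fun y => ?_
          by_cases hy : y ∈ Q3
          · simp [h, hy]
          · have := hP j
            simp [h, hy]; linarith
        have hM : ∏ j, M ^ (p / P j) = M := by
          rw [prod_rpow_const _ _ _ hnn, hsum1, ENNReal.rpow_one]
        have hx : ∀ j, (strongC n (β * p) (P j) * M * ∫⁻ y, h j y ^ P j) ^ (p / P j) =
            strongC n (β * p) (P j) ^ (p / P j) * M ^ (p / P j) *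
              ((∫⁻ y in Q3, g j y ^ P j) ^ (1 / P j)) ^ p := by
          intro j
          rw [ENNReal.mul_rpow_of_nonneg _ _ (hnn j (Finset.mem_univ j)),
            ENNReal.mul_rpow_of_nonneg _ _ (hnn j (Finset.mem_univ j)), hintg, ← ENNReal.rpow_mul]
          congr 2; ring
        simp_rw [hx]
        rw [Finset.prod_mul_distrib, Finset.prod_mul_distrib, hM, ENNReal.prod_rpow_of_nonneg hp0.le]
    _ ≤ (∏ j, strongC n (β * p) (P j) ^ (p / P j)) * M *
          (N * ENNReal.ofReal (3 * r) ^ ((n : ℝ) * (1 / p - 1 / p0))) ^ p := by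
        gcongr
        exact hN _ _ (by positivity)
    _ = _ := by
        have e1 : ENNReal.ofReal (3 * r) ^ ((n : ℝ) * (1 / p - 1 / p0)) =
          3 ^ ((n : ℝ) * (1 / p - 1 / p0)) * ENNReal.ofReal r ^ ((n : ℝ) * (1 / p - 1 / p0)) := by
          rw [ENNReal.ofReal_mul (by norm_num), ENNReal.mul_rpow_of_ne_top (by simp) (by simp)]
          simp
        have e2 : (ENNReal.ofReal r ^ ((n : ℝ) * (1 / p - 1 / p0))) ^ p =
          ENNReal.ofReal r ^ ((n : ℝ) * (1 - p / p0)) := by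
          rw [← ENNReal.rpow_mul]; congr 1; field_simp
        rw [e1, ENNReal.mul_rpow_of_nonneg _ _ hp0.le, ENNReal.mul_rpow_of_nonneg _ _ hp0.le, e2]
        unfold nearC; ring

/-- constant for the far part -/
def farC (n m : ℕ) (p p0 β : ℝ) : ℝ≥0∞ := bC n m p0 ^ p * geoC ((n / p0 - β) * p)

open Classical in
lemma far_le (hP : ∀ j, 1 < P j) (hp : 1 / p = ∑ j, 1 / P j) (hp0 : 0 < p)
    (hg : ∀ j, Measurable (g j))
    (hN : ∀ a r, 0 < r → ∏ j, (∫⁻ x in cube a r, g j x ^ P j) ^ (1 / P j) ≤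
      N * ENNReal.ofReal r ^ ((n : ℝ) * (1 / p - 1 / p0)))
    {β : ℝ} (hβn : β < n / p0)
    (μ : Measure (Fin n → ℝ)) (M : ℝ≥0∞)
    (hμ : ∀ a r, 0 < r → μ (cube a r) ≤ M * ENNReal.ofReal r ^ ((n : ℝ) - β * p))
    (a : Fin n → ℝ) (r : ℝ) (hr : 0 < r) :
    ∫⁻ x in cube a r, (∑' k : ℤ, if ENNReal.ofReal r ≤ pw k 1 then
        (pw k (β - (m : ℝ) * n) * ballProd g k x) ^ p else 0) ∂μ ≤
      farC n m p p0 β * M * N ^ p * ENNReal.ofReal r ^ ((n : ℝ) * (1 - p / p0)) := by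
  have hr0 : ENNReal.ofReal r ≠ 0 := by simpa using hr
  have hδ : 0 < (n / p0 - β) * p := mul_pos (by linarith) hp0
  have hpt : ∀ x, (∑' k : ℤ, if ENNReal.ofReal r ≤ pw k 1 then
        (pw k (β - (m : ℝ) * n) * ballProd g k x) ^ p else 0) ≤
        (bC n m p0 * N) ^ p * (geoC ((n / p0 - β) * p) *
          ENNReal.ofReal r ^ (-((n / p0 - β) * p))) := by
    intro x
    calc _ ≤ ∑' k : ℤ, (bC n m p0 * N) ^ p *
            (if ENNReal.ofReal r ≤ pw k 1 then pw k (-((n / p0 - β) * p)) else 0) := by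
          refine ENNReal.tsum_le_tsum fun k => ?_
          by_cases hk : ENNReal.ofReal r ≤ pw k 1
          · rw [if_pos hk, if_pos hk]
            have h1 : pw k (β - (m : ℝ) * n) * ballProd g k x ≤
                bC n m p0 * N * pw k (-(n / p0 - β)) := by
              calc _ ≤ pw k (β - (m : ℝ) * n) * (bC n m p0 * N * pw k ((m : ℝ) * n - n / p0)) := by
                    gcongr
                    exact ballProd_le hP hp hg hN k x
                _ = bC n m p0 * N * (pw k (β - (m : ℝ) * n) * pw k ((m : ℝ) * n - n / p0)) := by ring
                _ = _ := by rw [← pw_add]; congr 2; ring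
            refine (ENNReal.rpow_le_rpow h1 hp0.le).trans (le_of_eq ?_)
            rw [ENNReal.mul_rpow_of_nonneg _ _ hp0.le, pw_rpow]
            congr 2; ring
          · rw [if_neg hk]; exact zero_le
      _ ≤ _ := by
          rw [ENNReal.tsum_mul_left]
          exact mul_le_mul_right (geo_ge hδ _) _
  refine (lintegral_mono hpt).trans ?_
  rw [lintegral_const, Measure.restrict_apply_univ]
  refine (mul_le_mul_right (hμ a r hr) _).trans (le_of_eq ?_)
  have : ENNReal.ofReal r ^ ((n : ℝ) * (1 - p / p0)) =
      ENNReal.ofReal r ^ (-((n / p0 - β) * p)) * ENNReal.ofReal r ^ ((n : ℝ) - β * p) := by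
    rw [← ENNReal.rpow_add _ _ hr0 ENNReal.ofReal_ne_top]; congr 1; ring
  rw [this, ENNReal.mul_rpow_of_nonneg _ _ hp0.le]
  unfold farC; ring

open Classical in
lemma trace_le (hn : 0 < n) (hP : ∀ j, 1 < P j) (hp : 1 / p = ∑ j, 1 / P j) (hp0 : 0 < p)
    (hp1 : p ≤ 1) (hg : ∀ j, Measurable (g j))
    (hN : ∀ a r, 0 < r → ∏ j, (∫⁻ x in cube a r, g j x ^ P j) ^ (1 / P j) ≤
      N * ENNReal.ofReal r ^ ((n : ℝ) * (1 / p - 1 / p0)))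
    {β : ℝ} (hβ : 0 < β) (hβp : β * p < n) (hβn : β < n / p0)
    (μ : Measure (Fin n → ℝ)) (M : ℝ≥0∞)
    (hμ : ∀ a r, 0 < r → μ (cube a r) ≤ M * ENNReal.ofReal r ^ ((n : ℝ) - β * p))
    (a : Fin n → ℝ) (r : ℝ) (hr : 0 < r) :
    ∫⁻ x in cube a r, pot β g x ^ p ∂μ ≤
      (nearC n P p p0 (β * p) + farC n m p p0 β) * M * N ^ p *
        ENNReal.ofReal r ^ ((n : ℝ) * (1 - p / p0)) := by
  have hbm : ∀ k : ℤ, Measurable fun x => (pw k (β - (m : ℝ) * n) * ballProd g k x) ^ p :=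
    fun k => ((measurable_ballProd hg k).const_mul _).pow_const _
  calc _ ≤ ∫⁻ x in cube a r, ((∑' k : ℤ, if pw k 1 ≤ ENNReal.ofReal r then
        (pw k (β - (m : ℝ) * n) * ballProd g k x) ^ p else 0) +
        (∑' k : ℤ, if ENNReal.ofReal r ≤ pw k 1 then
        (pw k (β - (m : ℝ) * n) * ballProd g k x) ^ p else 0)) ∂μ := by
        refine lintegral_mono fun x => ?_
        refine (rpow_tsum_le' _ hp0 hp1).trans ?_
        rw [← ENNReal.tsum_add]
        refine ENNReal.tsum_le_tsum fun k => ?_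
        rcases le_total (pw k 1) (ENNReal.ofReal r) with h | h
        · rw [if_pos h]; exact le_self_add
        · rw [if_pos h]; exact le_add_self
    _ ≤ _ := by
        rw [lintegral_add_left]
        · refine (add_le_add (near_le hn hP hp hp0 hg hN hβ hβp μ M hμ a r hr)
            (far_le hP hp hp0 hg hN hβn μ M hμ a r hr)).trans (le_of_eq ?_)
          ring
        · refine Measurable.tsum fun k => ?_
          by_cases h : pw k 1 ≤ ENNReal.ofReal r
          · simp only [h, if_true]; exact hbm k
          · simp only [h, if_false]; exact measurable_const

/-- Hedberg constant -/
def hedC (n m : ℕ) (p0 α θ : ℝ) : ℝ≥0∞ := (1 + bC n m p0 * geoC (n / p0 - α)) ^ θ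

open Classical in
lemma hedberg (hP : ∀ j, 1 < P j) (hp : 1 / p = ∑ j, 1 / P j)
    (hg : ∀ j, Measurable (g j))
    (hN : ∀ a r, 0 < r → ∏ j, (∫⁻ x in cube a r, g j x ^ P j) ^ (1 / P j) ≤
      N * ENNReal.ofReal r ^ ((n : ℝ) * (1 / p - 1 / p0))) (hNt : N ≠ ∞)
    {α β θ : ℝ} (hβα : β ≤ α) (hα : α < n / p0) (hθ : θ = (n / p0 - β) / (n / p0 - α))
    (x : Fin n → ℝ) :
    pot α g x ^ θ ≤ hedC n m p0 α θ * pot β g x * N ^ (θ - 1) := by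
  have hδ : 0 < n / p0 - α := by linarith
  have hη : 0 < n / p0 - β := by linarith
  have hθ1 : 1 ≤ θ := by rw [hθ, le_div_iff₀ hδ]; linarith
  have hθ0 : 0 < θ := by linarith
  have hCpos : hedC n m p0 α θ ≠ 0 := by
    unfold hedC
    rw [Ne, ENNReal.rpow_eq_zero_iff_of_pos hθ0]
    simp
  by_cases hT0 : pot β g x = 0
  · have : pot α g x = 0 := by
      unfold pot at hT0 ⊢
      rw [ENNReal.tsum_eq_zero] at hT0 ⊢
      intro k
      have := hT0 k
      rw [mul_eq_zero] at this
      rw [this.resolve_left (pw_ne_zero _ _), mul_zero]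
    rw [this, ENNReal.zero_rpow_of_pos hθ0]; exact zero_le
  by_cases hN0 : N = 0
  · have : pot α g x = 0 := by
      unfold pot
      rw [ENNReal.tsum_eq_zero]
      intro k
      have := ballProd_le hP hp hg hN k x
      rw [hN0, mul_zero, zero_mul, nonpos_iff_eq_zero] at this
      rw [this, mul_zero]
    rw [this, ENNReal.zero_rpow_of_pos hθ0]; exact zero_le
  by_cases hTt : pot β g x = ∞
  · rw [hTt, ENNReal.mul_top hCpos, ENNReal.top_mul]
    · exact le_top
    · exact (ENNReal.rpow_pos (pos_iff_ne_zero.2 hN0) hNt).ne'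
  set T := pot β g x with hT
  have key : ∀ X : ℝ≥0∞, X ≠ 0 → X ≠ ∞ → pot α g x ≤ X ^ (α - β) * T +
      bC n m p0 * N * (geoC (n / p0 - α) * X ^ (-(n / p0 - α))) := by
    intro X hX0 hXt
    calc pot α g x ≤ ∑' k : ℤ, (X ^ (α - β) * (pw k (β - (m : ℝ) * n) * ballProd g k x) +
          bC n m p0 * N * (if X ≤ pw k 1 then pw k (-(n / p0 - α)) else 0)) := by
          unfold pot
          refine ENNReal.tsum_le_tsum fun k => ?_
          by_cases hk : X ≤ pw k 1
          · rw [if_pos hk]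
            refine le_trans ?_ le_add_self
            calc _ ≤ pw k (α - (m : ℝ) * n) * (bC n m p0 * N * pw k ((m : ℝ) * n - n / p0)) := by
                    gcongr
                    exact ballProd_le hP hp hg hN k x
                _ = bC n m p0 * N * (pw k (α - (m : ℝ) * n) * pw k ((m : ℝ) * n - n / p0)) := by ring
                _ = _ := by rw [← pw_add]; congr 2; ring
          · refine le_trans ?_ le_self_add
            rw [← mul_assoc]
            gcongr
            have : pw k (α - (m : ℝ) * n) = pw k 1 ^ (α - β) * pw k (β - (m : ℝ) * n) := by
              rw [← pw_eq_one_rpow, ← pw_add]; congr 1; ring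
            rw [this]
            exact mul_le_mul_left (ENNReal.rpow_le_rpow (not_le.1 hk).le (by linarith)) _
      _ ≤ _ := by
          rw [ENNReal.tsum_add, ENNReal.tsum_mul_left, ENNReal.tsum_mul_left]
          exact add_le_add (le_of_eq rfl) (mul_le_mul_right (geo_ge hδ _) _)
  have hNT0 : N / T ≠ 0 := by
    rw [Ne, ENNReal.div_eq_zero_iff]; push Not; exact ⟨hN0, hTt⟩
  have hNTt : N / T ≠ ∞ := ENNReal.div_ne_top hNt hT0
  set X := (N / T) ^ (1 / (n / p0 - β)) with hX
  have hX0 : X ≠ 0 := (ENNReal.rpow_pos (pos_iff_ne_zero.2 hNT0) hNTt).ne'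
  have hXt : X ≠ ∞ := ENNReal.rpow_ne_top_of_nonneg (by positivity) hNTt
  have hXη : X ^ (n / p0 - β) = N / T := by
    rw [hX, ← ENNReal.rpow_mul, one_div_mul_cancel hη.ne', ENNReal.rpow_one]
  have hXN : N * X ^ (-(n / p0 - α)) = X ^ (α - β) * T := by
    have h1 : X ^ (-(n / p0 - α)) = X ^ (α - β) * (X ^ (n / p0 - β))⁻¹ := by
      rw [← ENNReal.rpow_neg, ← ENNReal.rpow_add _ _ hX0 hXt]; congr 1; ring
    rw [h1, hXη, ENNReal.inv_div (Or.inl hTt) (Or.inl hT0), mul_left_comm,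
      ENNReal.mul_div_cancel hN0 hNt]
  have hmain : pot α g x ≤ (1 + bC n m p0 * geoC (n / p0 - α)) * (X ^ (α - β) * T) := by
    refine (key X hX0 hXt).trans (le_of_eq ?_)
    rw [add_mul, one_mul, ← hXN]; ring
  refine (ENNReal.rpow_le_rpow hmain hθ0.le).trans (le_of_eq ?_)
  rw [ENNReal.mul_rpow_of_nonneg _ _ hθ0.le, ENNReal.mul_rpow_of_nonneg _ _ hθ0.le,
    ← ENNReal.rpow_mul]
  have he : (α - β) * θ = (n / p0 - β) * (θ - 1) := by
    rw [hθ]; field_simp; ring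
  rw [he, ENNReal.rpow_mul, hXη, ENNReal.div_rpow_of_nonneg _ _ (by linarith)]
  have hTT : T ^ θ = T * T ^ (θ - 1) := by
    conv_rhs => rw [← ENNReal.rpow_one T, ← ENNReal.rpow_mul, ← ENNReal.rpow_add _ _ hT0 hTt]
    congr 1; ring
  have hT1 : T ^ (θ - 1) ≠ 0 := (ENNReal.rpow_pos (pos_iff_ne_zero.2 hT0) hTt).ne'
  have hT2 : T ^ (θ - 1) ≠ ∞ := ENNReal.rpow_ne_top_of_nonneg (by linarith) hTt
  rw [hTT, mul_left_comm (N ^ (θ - 1) / T ^ (θ - 1)), ENNReal.div_mul_cancel hT1 hT2]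
  unfold hedC; ring

end main
lemma weakC_ne_top {e : ℝ} (he : 0 < e) : weakC n e ≠ ∞ := by
  unfold weakC
  refine ENNReal.mul_ne_top (ENNReal.mul_ne_top (geoC_ne_top he) ?_) ?_
  · exact ENNReal.rpow_ne_top_of_ne_zero (by norm_num) (by norm_num)
  · exact ENNReal.rpow_ne_top_of_ne_zero (by norm_num) (by norm_num)

lemma strongC_ne_top {e s : ℝ} (he : 0 < e) (hs : 1 < s) : strongC n e s ≠ ∞ := by
  unfold strongC
  refine ENNReal.mul_ne_top ?_ (ENNReal.mul_ne_top (ENNReal.mul_ne_top (by norm_num)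
    (weakC_ne_top he)) (ENNReal.mul_ne_top (geoC_ne_top (by linarith)) ?_))
  · exact ENNReal.rpow_ne_top_of_ne_zero (by norm_num) (by norm_num)
  · refine ENNReal.rpow_ne_top_of_nonneg (by linarith) ?_
    first
      | exact ENNReal.rpow_ne_top_of_ne_zero (by norm_num) (by norm_num)
      | exact ENNReal.pow_ne_top (by norm_num)

lemma bC_ne_top (m : ℕ) (p0 : ℝ) : bC n m p0 ≠ ∞ :=
  ENNReal.rpow_ne_top_of_ne_zero (by norm_num) (by norm_num)

lemma nearC_ne_top {m : ℕ} {P : Fin m → ℝ} (hP : ∀ j, 1 < P j) {p e : ℝ} (p0 : ℝ) (hp : 0 < p)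
    (he : 0 < e) : nearC n P p p0 e ≠ ∞ := by
  unfold nearC
  refine ENNReal.mul_ne_top (ENNReal.prod_ne_top fun j _ => ?_) ?_
  · have := hP j
    exact ENNReal.rpow_ne_top_of_nonneg (by positivity) (strongC_ne_top he (hP j))
  · exact ENNReal.rpow_ne_top_of_nonneg hp.le
      (ENNReal.rpow_ne_top_of_ne_zero (by norm_num) (by norm_num))

lemma farC_ne_top (m : ℕ) {p p0 β : ℝ} (hp : 0 < p) (hβ : β < n / p0) :
    farC n m p p0 β ≠ ∞ := by
  unfold farC
  exact ENNReal.mul_ne_top (ENNReal.rpow_ne_top_of_nonneg hp.le (bC_ne_top _ _))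
    (geoC_ne_top (mul_pos (by linarith) hp))

lemma hedC_ne_top (m : ℕ) {p0 α θ : ℝ} (hα : α < n / p0) (hθ : 0 ≤ θ) :
    hedC n m p0 α θ ≠ ∞ := by
  unfold hedC
  exact ENNReal.rpow_ne_top_of_nonneg hθ (ENNReal.add_ne_top.2 ⟨by norm_num,
    ENNReal.mul_ne_top (bC_ne_top _ _) (geoC_ne_top (by linarith))⟩)

theorem statement10 (hn : 0 < n) (m : ℕ) (hm : 0 < m)
    (P : Fin m → ℝ) (hP : ∀ j, 1 < P j) (p p0 α β θ q q0 : ℝ)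
    (hp : 1 / p = ∑ j, 1 / P j)
    (hp0 : 0 < p) (hpp0 : p ≤ p0) (hp1 : p ≤ 1) (hp0n : p0 < n / α)
    (hβ : 0 < β) (hβα : β ≤ α) (hα : α < (m : ℝ) * n)
    (hθ : θ = (n - β * p0) / (n - α * p0)) (hq : q = θ * p) (hq0 : q0 = θ * p0) :
    ∃ C : ℝ≥0∞, 0 < C ∧ C < ∞ ∧
      ∀ μ : Measure (Fin n → ℝ), IsLocallyFiniteMeasure μ →
        ∀ f : Fin m → (Fin n → ℝ) → ℝ,
          radonMorreyNorm μ q q0 (fracIntegral α f) ≤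
            C * measureGrowthNorm μ (n - β * p) ^ (1 / q) *
              prodMorreyNorm P p p0 f := by
  have hα0 : 0 < α := hβ.trans_le hβα
  have hp00 : 0 < p0 := hp0.trans_le hpp0
  have hαp : α * p0 < n := by
    rw [lt_div_iff₀ hα0] at hp0n; linarith
  have hαn : α < n / p0 := by rwa [lt_div_iff₀ hp00]
  have hβn : β < n / p0 := by linarith
  have hβp : β * p < n := by nlinarith
  have hθ' : θ = (n / p0 - β) / (n / p0 - α) := by
    have h1 : (n : ℝ) - α * p0 ≠ 0 := by linarith
    have h2 : (n : ℝ) / p0 - α ≠ 0 := by linarith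
    rw [hθ, div_eq_div_iff h1 h2]
    field_simp
  have hθ1 : 1 ≤ θ := by
    rw [hθ', le_div_iff₀ (by linarith)]; linarith
  have hθ0 : 0 < θ := by linarith
  have hqpos : 0 < q := by rw [hq]; positivity
  set A : ℝ≥0∞ := 2 ^ ((m : ℝ) * n - α) with hA
  have hAt : A ≠ ∞ := ENNReal.rpow_ne_top_of_ne_zero (by norm_num) (by norm_num)
  set C1 : ℝ≥0∞ := (A ^ θ * hedC n m p0 α θ) ^ p with hC1
  set C2 : ℝ≥0∞ := nearC n P p p0 (β * p) + farC n m p p0 β with hC2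
  have hC1t : C1 ≠ ∞ := ENNReal.rpow_ne_top_of_nonneg hp0.le
    (ENNReal.mul_ne_top (ENNReal.rpow_ne_top_of_nonneg hθ0.le hAt) (hedC_ne_top m hαn hθ0.le))
  have hC2t : C2 ≠ ∞ := ENNReal.add_ne_top.2
    ⟨nearC_ne_top hP p0 hp0 (by positivity), farC_ne_top m hp0 hβn⟩
  have hC0t : (C1 * C2) ^ (1 / q) ≠ ∞ :=
    ENNReal.rpow_ne_top_of_nonneg (by positivity) (ENNReal.mul_ne_top hC1t hC2t)
  refine ⟨(C1 * C2) ^ (1 / q) + 1, by positivity,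
    ENNReal.add_lt_top.2 ⟨hC0t.lt_top, by norm_num⟩, ?_⟩
  intro μ _ f
  set M := measureGrowthNorm μ (n - β * p) with hM
  set N := prodMorreyNorm P p p0 f with hNdef
  have hrr : ∀ r : ℝ, 0 < r → ENNReal.ofReal r ≠ 0 := fun r hr => by simpa using hr
  have hμ : ∀ a r, 0 < r → μ (cube a r) ≤ M * ENNReal.ofReal r ^ ((n : ℝ) - β * p) := by
    intro a r hr
    have h1 : μ (cube a r) / ENNReal.ofReal r ^ ((n : ℝ) - β * p) ≤ M := by
      rw [hM]; unfold measureGrowthNorm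
      exact le_iSup_of_le a (le_iSup_of_le r (le_iSup_of_le hr le_rfl))
    rwa [ENNReal.div_le_iff] at h1
    · exact (ENNReal.rpow_pos (pos_iff_ne_zero.2 (hrr r hr)) ENNReal.ofReal_ne_top).ne'
    · exact ENNReal.rpow_ne_top_of_ne_zero (hrr r hr) ENNReal.ofReal_ne_top
  unfold radonMorreyNorm
  refine iSup_le fun a => iSup_le fun r => iSup_le fun hr => ?_
  have hR0 := hrr r hr
  have hRt : ENNReal.ofReal r ≠ ∞ := ENNReal.ofReal_ne_top
  by_cases hM0 : M = 0
  · have h0 : μ (cube a r) = 0 := by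
      have := hμ a r hr
      rwa [hM0, zero_mul, nonpos_iff_eq_zero] at this
    rw [Measure.restrict_eq_zero.2 h0, lintegral_zero_measure,
      ENNReal.zero_rpow_of_pos (by positivity), mul_zero]
    exact zero_le
  by_cases hNt : N = ∞
  · rw [hNt, ENNReal.mul_top]
    · exact le_top
    · refine mul_ne_zero (by simp) ?_
      rw [Ne, ENNReal.rpow_eq_zero_iff_of_pos (by positivity)]
      exact hM0
  choose g hgm hgle hgint using fun j : Fin m =>
    exists_measurable_le_forall_setLIntegral_eq volume (fun y => ENNReal.ofReal |f j y|)
  have hN : ∀ a r, 0 < r → ∏ j, (∫⁻ x in cube a r, g j x ^ P j) ^ (1 / P j) ≤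
      N * ENNReal.ofReal r ^ ((n : ℝ) * (1 / p - 1 / p0)) := by
    intro a r hr
    have hR0 := hrr r hr
    have hRt : ENNReal.ofReal r ≠ ∞ := ENNReal.ofReal_ne_top
    have h1 : volume (cube a r) ^ (1 / p0 - 1 / p) *
      ∏ j, (∫⁻ x in cube a r, ENNReal.ofReal |f j x| ^ P j) ^ (1 / P j) ≤ N := by
      rw [hNdef]; unfold prodMorreyNorm
      exact le_iSup_of_le a (le_iSup_of_le r (le_iSup_of_le hr le_rfl))
    have h2 : ∏ j, (∫⁻ x in cube a r, g j x ^ P j) ^ (1 / P j) ≤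
        ∏ j, (∫⁻ x in cube a r, ENNReal.ofReal |f j x| ^ P j) ^ (1 / P j) := by
      refine Finset.prod_le_prod' fun j _ => ?_
      have := hP j
      refine ENNReal.rpow_le_rpow (lintegral_mono fun x => ?_) (by positivity)
      exact ENNReal.rpow_le_rpow (hgle j x) (by positivity)
    refine h2.trans ?_
    rw [volume_cube, ← ENNReal.rpow_mul] at h1
    refine le_trans (le_of_eq ?_) (mul_le_mul_left h1 _)
    rw [mul_right_comm, ← ENNReal.rpow_add _ _ hR0 hRt]
    have : (n : ℝ) * (1 / p0 - 1 / p) + n * (1 / p - 1 / p0) = 0 := by ring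
    rw [this, ENNReal.rpow_zero, one_mul]
  have hI : ∀ x, fracIntegral α f x ≤ A * pot α g x := by
    intro x
    refine (fracIntegral_le hn hm hα f x).trans (le_of_eq ?_)
    unfold pot ballProd
    simp only [hgint]
    rfl
  have hIq : ∀ x, fracIntegral α f x ^ q ≤ C1 * (N ^ (θ - 1)) ^ p * pot β g x ^ p := by
    intro x
    rw [hq, ENNReal.rpow_mul, hC1, ← ENNReal.mul_rpow_of_nonneg _ _ hp0.le,
      ← ENNReal.mul_rpow_of_nonneg _ _ hp0.le]
    refine ENNReal.rpow_le_rpow ?_ hp0.le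
    refine (ENNReal.rpow_le_rpow (hI x) hθ0.le).trans ?_
    rw [ENNReal.mul_rpow_of_nonneg _ _ hθ0.le]
    refine (mul_le_mul_right (hedberg hP hp hgm hN hNt hβα hαn hθ' x) _).trans (le_of_eq ?_)
    ring
  have hintg : ∫⁻ x in cube a r, fracIntegral α f x ^ q ∂μ ≤
      (C1 * C2) * M * N ^ q * ENNReal.ofReal r ^ ((n : ℝ) * (1 - p / p0)) := by
    calc _ ≤ ∫⁻ x in cube a r, C1 * (N ^ (θ - 1)) ^ p * pot β g x ^ p ∂μ := lintegral_mono hIq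
      _ = C1 * (N ^ (θ - 1)) ^ p * ∫⁻ x in cube a r, pot β g x ^ p ∂μ :=
          lintegral_const_mul _ ((measurable_pot β hgm).pow_const p)
      _ ≤ C1 * (N ^ (θ - 1)) ^ p * (C2 * M * N ^ p *
            ENNReal.ofReal r ^ ((n : ℝ) * (1 - p / p0))) :=
          mul_le_mul_right (trace_le hn hP hp hp0 hp1 hgm hN hβ hβp hβn μ M hμ a r hr) _
      _ = (C1 * C2) * M * ((N ^ (θ - 1)) ^ p * N ^ p) *
            ENNReal.ofReal r ^ ((n : ℝ) * (1 - p / p0)) := by ring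
      _ = _ := by
          have : (N ^ (θ - 1)) ^ p * N ^ p = N ^ q := by
            rw [← ENNReal.rpow_mul, ← ENNReal.rpow_add_of_nonneg _ _
              (mul_nonneg (by linarith) hp0.le) hp0.le, hq]
            congr 1; ring
          rw [this]
  have hqi : 0 ≤ 1 / q := by positivity
  calc _ ≤ volume (cube a r) ^ (1 / q0 - 1 / q) *
        ((C1 * C2) * M * N ^ q * ENNReal.ofReal r ^ ((n : ℝ) * (1 - p / p0))) ^ (1 / q) :=
        mul_le_mul_right (ENNReal.rpow_le_rpow hintg hqi) _
    _ = (C1 * C2) ^ (1 / q) * M ^ (1 / q) * N * (ENNReal.ofReal r ^ (n * (1 / q0 - 1 / q)) *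
        ENNReal.ofReal r ^ (((n : ℝ) * (1 - p / p0)) * (1 / q))) := by
        rw [volume_cube, ENNReal.mul_rpow_of_nonneg _ _ hqi, ENNReal.mul_rpow_of_nonneg _ _ hqi,
          ENNReal.mul_rpow_of_nonneg _ _ hqi, ← ENNReal.rpow_mul, ← ENNReal.rpow_mul,
          ← ENNReal.rpow_mul, mul_one_div_cancel hqpos.ne', ENNReal.rpow_one]
        ring
    _ = (C1 * C2) ^ (1 / q) * M ^ (1 / q) * N := by
        rw [← ENNReal.rpow_add _ _ hR0 hRt]
        have : (n : ℝ) * (1 / q0 - 1 / q) + ((n : ℝ) * (1 - p / p0)) * (1 / q) = 0 := by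
          rw [hq0, hq]; field_simp; ring
        rw [this, ENNReal.rpow_zero, mul_one]
    _ ≤ _ := mul_le_mul_left (mul_le_mul_left le_self_add _) _
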